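/- Let (H, A, ‖·‖♯) be a compressed sensing space with bound L > 0, let Φ : H → ℝ^M be linear, and suppose ρ > 0 satisfies ρ < 1/(2L) and Φ satisfies the (ρ,α)-robust width property over the unit ♯-ball for some α > 0. Set C₀ = (1/(2ρ) − L)⁻¹ and C₁ = 2/(α²ρ). Then for every x♮ ∈ H, every λ > 0, and every ω ∈ ℝ^M with ‖Φᵀω‖♦ ≤ λ, any x* that minimizes ‖x‖♯ subject to the constraint ‖Φᵀ(Φx − (Φx♮ + ω))‖♦ ≤ λ satisfies ‖x* − x♮‖₂ ≤ C₀‖x♮ − a‖♯ + C₁·λ for every a ∈ A. -/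

import Mathlib

noncomputable section

open scoped RealInnerProductSpace

variable {H : Type*} [NormedAddCommGroup H] [InnerProductSpace ℝ H] [FiniteDimensional ℝ H]

/-- `sharp` is a norm on `H`. -/
structure IsNormOn (sharp : H → ℝ) : Prop where
  triangle : ∀ x y : H, sharp (x + y) ≤ sharp x + sharp y
  smul_eq : ∀ (c : ℝ) (x : H), sharp (c • x) = |c| * sharp x
  eq_zero_of : ∀ x : H, sharp x = 0 → x = 0

/-- The dual norm of `sharp`: `‖u‖♦ = sup {|⟨u,v⟩| : ‖v‖♯ ≤ 1}`. -/
def dualNorm (sharp : H → ℝ) (u : H) : ℝ :=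
  sSup {r : ℝ | ∃ v : H, sharp v ≤ 1 ∧ r = |⟪u, v⟫|}

/-- The subdifferential of `f` at `x`. -/
def subdiff (f : H → ℝ) (x : H) : Set H :=
  {u : H | ∀ y : H, f y ≥ f x + ⟪u, y - x⟫}

/-- `(H, A, sharp)` is a compressed sensing space with bound `L`. -/
structure IsCSSpace (A : Set H) (sharp : H → ℝ) (L : ℝ) : Prop where
  zero_mem : (0 : H) ∈ A
  decomp : ∀ a ∈ A, ∀ v : H, ∃ z₁ z₂ : H, v = z₁ + z₂ ∧
    sharp (a + z₁) = sharp a + sharp z₁ ∧ sharp z₂ ≤ L * ‖v‖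

/-- `Φ` satisfies the `(ρ, α)`-robust width property over the unit `sharp`-ball. -/
def RobustWidth {M : ℕ} (Φ : H →ₗ[ℝ] EuclideanSpace ℝ (Fin M)) (sharp : H → ℝ)
    (ρ α : ℝ) : Prop :=
  ∀ x : H, ‖Φ x‖ < α * ‖x‖ → ‖x‖ ≤ ρ * sharp x

section

variable {E : Type*} [NormedAddCommGroup E] [InnerProductSpace ℝ E] {sharp : E → ℝ}

lemma IsNormOn.zero (hs : IsNormOn sharp) : sharp 0 = 0 := by
  simpa using hs.smul_eq 0 0

lemma IsNormOn.neg (hs : IsNormOn sharp) (x : E) : sharp (-x) = sharp x := by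
  simpa using hs.smul_eq (-1) x

lemma IsNormOn.nonneg (hs : IsNormOn sharp) (x : E) : 0 ≤ sharp x := by
  have h := hs.triangle x (-x)
  rw [add_neg_cancel, hs.zero, hs.neg] at h
  linarith

lemma IsNormOn.pos (hs : IsNormOn sharp) {x : E} (hx : x ≠ 0) : 0 < sharp x :=
  (hs.nonneg x).lt_of_ne fun h => hx (hs.eq_zero_of x h.symm)

lemma dualNorm_neg (sharp : E → ℝ) (u : E) : dualNorm sharp (-u) = dualNorm sharp u := by
  simp [dualNorm, inner_neg_left]

/-- In a compressed sensing space, a vector whose `sharp` norm does not exceed that of `x` differs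
from `x` by a vector controlled by the distance from `x` to `A`. -/
lemma IsCSSpace.sharp_sub_le {A : Set E} {L : ℝ} (hcs : IsCSSpace A sharp L)
    (hs : IsNormOn sharp) {x y a : E} (ha : a ∈ A) (hyx : sharp y ≤ sharp x) :
    sharp (y - x) ≤ 2 * sharp (x - a) + 2 * L * ‖y - x‖ := by
  obtain ⟨z₁, z₂, hz, hadd, hz₂⟩ := hcs.decomp a ha (y - x)
  have hx : sharp x ≤ sharp a + sharp (x - a) := by
    simpa using hs.triangle a (x - a)
  have haz : sharp (a + z₁) ≤ sharp y + sharp (x - a) + sharp z₂ := by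
    have h₁ := hs.triangle y (-(x - a) + -z₂)
    have h₂ := hs.triangle (-(x - a)) (-z₂)
    rw [hs.neg, hs.neg] at h₂
    have h : y + (-(x - a) + -z₂) = a + z₁ := by
      rw [← sub_eq_iff_eq_add.2 hz]; abel
    rw [h] at h₁
    linarith
  have hyx' : sharp (y - x) ≤ sharp z₁ + sharp z₂ := hz ▸ hs.triangle z₁ z₂
  linarith

end

namespace IsNormOn

variable {sharp : H → ℝ}

lemma continuous (hs : IsNormOn sharp) : Continuous sharp :=
  (Seminorm.of (𝕜 := ℝ) sharp hs.triangle hs.smul_eq).convexOn.locallyLipschitz.continuous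

/-- The Euclidean norm is dominated by a multiple of any other norm. -/
lemma exists_norm_le (hs : IsNormOn sharp) : ∃ C : ℝ, ∀ v : H, ‖v‖ ≤ C * sharp v := by
  rcases subsingleton_or_nontrivial H with _ | _
  · exact ⟨0, fun v => by simp [Subsingleton.elim v 0]⟩
  obtain ⟨x, hx, hmin⟩ := (isCompact_sphere (0 : H) 1).exists_isMinOn
    (NormedSpace.sphere_nonempty.2 zero_le_one) hs.continuous.continuousOn
  have hxpos : 0 < sharp x := hs.pos (ne_zero_of_mem_unit_sphere ⟨x, hx⟩)
  refine ⟨(sharp x)⁻¹, fun v => ?_⟩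
  rcases eq_or_ne v 0 with rfl | hv
  · simp [hs.zero]
  have hv' : 0 < ‖v‖ := norm_pos_iff.2 hv
  have h : sharp x ≤ sharp (‖v‖⁻¹ • v) := hmin (by simp [norm_smul, hv'.ne'])
  rw [hs.smul_eq, abs_of_pos (inv_pos.2 hv'), ← div_eq_inv_mul, le_div_iff₀ hv'] at h
  rwa [← div_eq_inv_mul, le_div_iff₀ hxpos, mul_comm]

lemma bddAbove_dualNorm (hs : IsNormOn sharp) (u : H) :
    BddAbove {r : ℝ | ∃ v : H, sharp v ≤ 1 ∧ r = |⟪u, v⟫|} := by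
  obtain ⟨C, hC⟩ := hs.exists_norm_le
  refine ⟨‖u‖ * |C|, ?_⟩
  rintro _ ⟨v, hv, rfl⟩
  refine (abs_real_inner_le_norm u v).trans (mul_le_mul_of_nonneg_left ?_ (norm_nonneg u))
  calc ‖v‖ ≤ C * sharp v := hC v
    _ ≤ |C| * 1 := mul_le_mul (le_abs_self C) hv (hs.nonneg v) (abs_nonneg C)
    _ = |C| := mul_one _

/-- The duality inequality between a norm and its dual norm. -/
lemma abs_inner_le (hs : IsNormOn sharp) (u v : H) :
    |⟪u, v⟫| ≤ dualNorm sharp u * sharp v := by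
  rcases eq_or_ne v 0 with rfl | hv
  · simp [hs.zero]
  have hpos := hs.pos hv
  have h : |⟪u, (sharp v)⁻¹ • v⟫| ≤ dualNorm sharp u := by
    refine le_csSup (hs.bddAbove_dualNorm u) ⟨_, ?_, rfl⟩
    rw [hs.smul_eq, abs_of_pos (inv_pos.2 hpos), inv_mul_cancel₀ hpos.ne']
  rwa [real_inner_smul_right, abs_mul, abs_of_pos (inv_pos.2 hpos), ← div_eq_inv_mul,
    div_le_iff₀ hpos] at h

end IsNormOn

theorem dantzig_of_robustWidth {M : ℕ} (sharp : H → ℝ) (hs : IsNormOn sharp)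
    (A : Set H) (L : ℝ) (hL : 0 < L) (hcs : IsCSSpace A sharp L)
    (Φ : H →ₗ[ℝ] EuclideanSpace ℝ (Fin M))
    (ρ α : ℝ) (hα : 0 < α) (hρ : 0 < ρ) (hρL : ρ < 1 / (2 * L))
    (hrw : RobustWidth Φ sharp ρ α)
    (C₀ C₁ : ℝ) (hC₀ : C₀ = (1 / (2 * ρ) - L)⁻¹) (hC₁ : C₁ = 2 / (α ^ 2 * ρ))
    (xnat : H) (lam : ℝ) (hlam : 0 < lam) (ω : EuclideanSpace ℝ (Fin M))
    (hω : dualNorm sharp ((LinearMap.adjoint Φ) ω) ≤ lam)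
    (xstar : H)
    (hfeas : dualNorm sharp ((LinearMap.adjoint Φ) (Φ xstar - (Φ xnat + ω))) ≤ lam)
    (hmin : ∀ x : H,
      dualNorm sharp ((LinearMap.adjoint Φ) (Φ x - (Φ xnat + ω))) ≤ lam →
        sharp xstar ≤ sharp x) :
    ∀ a ∈ A, ‖xstar - xnat‖ ≤ C₀ * sharp (xnat - a) + C₁ * lam := by
  intro a ha
  set h : H := xstar - xnat with hh
  have hcone : sharp h ≤ 2 * sharp (xnat - a) + 2 * L * ‖h‖ := by
    refine hcs.sharp_sub_le hs ha (hmin xnat ?_)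
    rwa [sub_add_cancel_left, map_neg, dualNorm_neg]
  have hρL' : 2 * ρ * L < 1 := by
    rw [lt_div_iff₀ (by positivity)] at hρL
    linarith
  have hC₀' : C₀ = 2 * ρ / (1 - 2 * ρ * L) := by
    rw [hC₀, ← inv_div]
    field_simp
  have hC₀pos : 0 ≤ C₀ := by
    rw [hC₀']
    exact div_nonneg (by positivity) (by linarith)
  have hC₁pos : 0 ≤ C₁ := by
    rw [hC₁]
    positivity
  have he := hs.nonneg (xnat - a)
  by_cases hle : ‖h‖ ≤ ρ * sharp h
  · have hbound : ‖h‖ ≤ C₀ * sharp (xnat - a) := by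
      rw [hC₀', div_mul_eq_mul_div, le_div_iff₀ (by linarith)]
      nlinarith [mul_le_mul_of_nonneg_left hcone hρ.le]
    linarith [mul_nonneg hC₁pos hlam.le]
  · have hΦ : α * ‖h‖ ≤ ‖Φ h‖ := not_lt.1 fun hlt => hle (hrw h hlt)
    have hs0 := hs.nonneg h
    have hnorm : 0 < ‖h‖ := (mul_nonneg hρ.le hs0).trans_lt (not_le.1 hle)
    have hinner : ‖Φ h‖ ^ 2 ≤ 2 * lam * sharp h := by
      have hsplit : ‖Φ h‖ ^ 2 =
          ⟪LinearMap.adjoint Φ (Φ xstar - (Φ xnat + ω)), h⟫ + ⟪LinearMap.adjoint Φ ω, h⟫ := by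
        rw [← inner_add_left, ← map_add, LinearMap.adjoint_inner_left,
          ← real_inner_self_eq_norm_sq]
        congr 1
        rw [hh, map_sub]
        abel
      have h₁ := (le_abs_self _).trans
        (hs.abs_inner_le (LinearMap.adjoint Φ (Φ xstar - (Φ xnat + ω))) h)
      have h₂ := (le_abs_self _).trans (hs.abs_inner_le (LinearMap.adjoint Φ ω) h)
      nlinarith [mul_le_mul_of_nonneg_right hfeas hs0, mul_le_mul_of_nonneg_right hω hs0]
    have hsq : (α * ‖h‖) ^ 2 ≤ ‖Φ h‖ ^ 2 := pow_le_pow_left₀ (by positivity) hΦ 2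
    have hbound : ‖h‖ ≤ C₁ * lam := by
      rw [hC₁, div_mul_eq_mul_div, le_div_iff₀ (by positivity)]
      refine le_of_mul_le_mul_right ?_ hnorm
      calc ‖h‖ * (α ^ 2 * ρ) * ‖h‖ = ρ * (α * ‖h‖) ^ 2 := by ring
        _ ≤ ρ * (2 * lam * sharp h) := mul_le_mul_of_nonneg_left (hsq.trans hinner) hρ.le
        _ = 2 * lam * (ρ * sharp h) := by ring
        _ ≤ 2 * lam * ‖h‖ := mul_le_mul_of_nonneg_left (not_le.1 hle).le (by positivity)
    linarith [mul_nonneg hC₀pos he]
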